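/- The map S₂ given by (x₁,x₂,y₁,y₂,z₁,z₂,t₁,t₂) ↦ (x₁y₁, x₂y₂/D, 1, D, t₁, y₁y₂z₁z₂/(t₁D), z₁, t₁t₂/z₁), where D = x₁x₂+z₁z₂+x₁x₂y₁y₂z₁z₂, satisfies the set-theoretical 4-simplex equation wherever all denominators are nonzero. -/

import Mathlib

/-- The electric network type 4-simplex map `S₂`, where
`D = x₁x₂ + z₁z₂ + x₁x₂y₁y₂z₁z₂`. -/
noncomputable def enS2 :
    (ℂ × ℂ) × (ℂ × ℂ) × (ℂ × ℂ) × (ℂ × ℂ) → (ℂ × ℂ) × (ℂ × ℂ) × (ℂ × ℂ) × (ℂ × ℂ) :=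
  fun ((x1, x2), (y1, y2), (z1, z2), (t1, t2)) =>
    let D := x1 * x2 + z1 * z2 + x1 * x2 * y1 * y2 * z1 * z2
    ((x1 * y1, x2 * y2 / D),
     (1, D),
     (t1, y1 * y2 * z1 * z2 / (t1 * D)),
     (z1, t1 * t2 / z1))

/-- All denominators occurring in the electric network type map `S₂` are nonzero. -/
def enS2Ok : (ℂ × ℂ) × (ℂ × ℂ) × (ℂ × ℂ) × (ℂ × ℂ) → Prop :=
  fun ((x1, x2), (y1, y2), (z1, z2), (t1, t2)) =>
    x1 * x2 + z1 * z2 + x1 * x2 * y1 * y2 * z1 * z2 ≠ 0 ∧ t1 ≠ 0 ∧ z1 ≠ 0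

section Lifts
variable {X : Type*} (S : X × X × X × X → X × X × X × X)

/-- `S` acting on factors 1,2,3,4 of a 10-tuple. -/
def lift1234 : X × X × X × X × X × X × X × X × X × X → X × X × X × X × X × X × X × X × X × X :=
  fun (p1, p2, p3, p4, p5, p6, p7, p8, p9, p10) =>
    let q := S (p1, p2, p3, p4)
    (q.1, q.2.1, q.2.2.1, q.2.2.2, p5, p6, p7, p8, p9, p10)

/-- `S` acting on factors 1,5,6,7 of a 10-tuple. -/
def lift1567 : X × X × X × X × X × X × X × X × X × X → X × X × X × X × X × X × X × X × X × X :=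
  fun (p1, p2, p3, p4, p5, p6, p7, p8, p9, p10) =>
    let q := S (p1, p5, p6, p7)
    (q.1, p2, p3, p4, q.2.1, q.2.2.1, q.2.2.2, p8, p9, p10)

/-- `S` acting on factors 2,5,8,9 of a 10-tuple. -/
def lift2589 : X × X × X × X × X × X × X × X × X × X → X × X × X × X × X × X × X × X × X × X :=
  fun (p1, p2, p3, p4, p5, p6, p7, p8, p9, p10) =>
    let q := S (p2, p5, p8, p9)
    (p1, q.1, p3, p4, q.2.1, p6, p7, q.2.2.1, q.2.2.2, p10)

/-- `S` acting on factors 3,6,8,10 of a 10-tuple. -/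
def lift368X : X × X × X × X × X × X × X × X × X × X → X × X × X × X × X × X × X × X × X × X :=
  fun (p1, p2, p3, p4, p5, p6, p7, p8, p9, p10) =>
    let q := S (p3, p6, p8, p10)
    (p1, p2, q.1, p4, p5, q.2.1, p7, q.2.2.1, p9, q.2.2.2)

/-- `S` acting on factors 4,7,9,10 of a 10-tuple. -/
def lift479X : X × X × X × X × X × X × X × X × X × X → X × X × X × X × X × X × X × X × X × X :=
  fun (p1, p2, p3, p4, p5, p6, p7, p8, p9, p10) =>
    let q := S (p4, p7, p9, p10)
    (p1, p2, p3, q.1, p5, p6, q.2.1, p8, q.2.2.1, q.2.2.2)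

end Lifts

section Projs
variable {X : Type*}

/-- Projection on factors 1,2,3,4. -/
def proj1234 : X × X × X × X × X × X × X × X × X × X → X × X × X × X :=
  fun (p1, p2, p3, p4, _, _, _, _, _, _) => (p1, p2, p3, p4)

/-- Projection on factors 1,5,6,7. -/
def proj1567 : X × X × X × X × X × X × X × X × X × X → X × X × X × X :=
  fun (p1, _, _, _, p5, p6, p7, _, _, _) => (p1, p5, p6, p7)

/-- Projection on factors 2,5,8,9. -/
def proj2589 : X × X × X × X × X × X × X × X × X × X → X × X × X × X :=
  fun (_, p2, _, _, p5, _, _, p8, p9, _) => (p2, p5, p8, p9)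

/-- Projection on factors 3,6,8,10. -/
def proj368X : X × X × X × X × X × X × X × X × X × X → X × X × X × X :=
  fun (_, _, p3, _, _, p6, _, p8, _, p10) => (p3, p6, p8, p10)

/-- Projection on factors 4,7,9,10. -/
def proj479X : X × X × X × X × X × X × X × X × X × X → X × X × X × X :=
  fun (_, _, _, p4, _, _, p7, _, p9, p10) => (p4, p7, p9, p10)

end Projs

/-- The electric network type map `S₂` satisfies the set-theoretical
4-simplex equation, wherever all denominators are nonzero. -/
theorem enS2_four_simplex (p : (ℂ × ℂ) × (ℂ × ℂ) × (ℂ × ℂ) × (ℂ × ℂ) × (ℂ × ℂ) × (ℂ × ℂ) × (ℂ × ℂ) × (ℂ × ℂ) × (ℂ × ℂ) × (ℂ × ℂ))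
    (h1 : enS2Ok (proj479X p))
    (h2 : enS2Ok (proj368X (lift479X enS2 p)))
    (h3 : enS2Ok (proj2589 (lift368X enS2 (lift479X enS2 p))))
    (h4 : enS2Ok (proj1567 (lift2589 enS2 (lift368X enS2 (lift479X enS2 p)))))
    (h5 : enS2Ok (proj1234 (lift1567 enS2 (lift2589 enS2 (lift368X enS2 (lift479X enS2 p))))))
    (h6 : enS2Ok (proj1234 p))
    (h7 : enS2Ok (proj1567 (lift1234 enS2 p)))
    (h8 : enS2Ok (proj2589 (lift1567 enS2 (lift1234 enS2 p))))
    (h9 : enS2Ok (proj368X (lift2589 enS2 (lift1567 enS2 (lift1234 enS2 p)))))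
    (h10 : enS2Ok (proj479X (lift368X enS2 (lift2589 enS2 (lift1567 enS2 (lift1234 enS2 p)))))) :
    lift1234 enS2 (lift1567 enS2 (lift2589 enS2 (lift368X enS2 (lift479X enS2 p))))
      = lift479X enS2 (lift368X enS2 (lift2589 enS2 (lift1567 enS2 (lift1234 enS2 p)))) := by
  obtain ⟨⟨a1, b1⟩, ⟨a2, b2⟩, ⟨a3, b3⟩, ⟨a4, b4⟩, ⟨a5, b5⟩, ⟨a6, b6⟩, ⟨a7, b7⟩, ⟨a8, b8⟩,
    ⟨a9, b9⟩, ⟨a10, b10⟩⟩ := p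
  simp only [enS2Ok, enS2, proj1234, proj1567, proj2589, proj368X, proj479X, lift1234, lift1567,
    lift2589, lift368X, lift479X, Prod.mk.injEq, mul_one, one_mul] at *
  obtain ⟨hA, ha10, ha9⟩ := h1
  obtain ⟨hB, -, ha8⟩ := h2
  obtain ⟨hP, ha4, ha3⟩ := h6
  obtain ⟨hQ, ha7, ha6⟩ := h7
  obtain ⟨hC, -⟩ := h3
  obtain ⟨hF, -⟩ := h4
  obtain ⟨hG, -⟩ := h5
  obtain ⟨hR, -⟩ := h8
  obtain ⟨hT, -⟩ := h9
  clear h10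
  have cancel {a : ℂ} (ha : a ≠ 0) (b c : ℂ) : a * (b / (a * c)) = b / c := by field_simp
  have cancel' {a : ℂ} (ha : a ≠ 0) (u b c : ℂ) : u * a * (b / (a * c)) = u * (b / c) := by
    field_simp
  have cancel'' {a : ℂ} (ha : a ≠ 0) (u b : ℂ) : u * a * (b / a) = u * b := by
    field_simp
  simp only [cancel ha4, cancel ha7, cancel ha9, cancel' ha7, cancel' ha9, mul_div_cancel₀ _ ha3,
    mul_div_cancel₀ _ ha8, cancel'' ha6, cancel'' ha8, ← mul_assoc] at hQ hC hF hG hR hT ⊢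
  generalize eA : a4 * b4 + a9 * b9 + a4 * b4 * a7 * b7 * a9 * b9 = A at hA ⊢
  generalize eB : a3 * b3 + a8 * b8 + a3 * b3 * a6 * b6 * a8 * b8 = B at hB hC hF hG ⊢
  generalize eP : a1 * b1 + a3 * b3 + a1 * b1 * a2 * b2 * a3 * b3 = P at hP hQ hR hT ⊢
  generalize eC : a2 * b2 + a6 * b6 * a8 * b8 / B + a2 * b2 * a5 * b5 * (a6 * b6 * a8 * b8 / B)
    = C at hC hF hG ⊢
  generalize eQ : a1 * a2 * (b1 * b2 / P) + a6 * b6 + a1 * a2 * (b1 * b2 / P) * a5 * b5 * a6 * b6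
    = Q at hQ hR hT ⊢
  generalize eF : a1 * b1 + B + a1 * b1 * C * B = F at hF hG ⊢
  generalize eR : P + a8 * b8 + P * Q * a8 * b8 = R at hR hT ⊢
  generalize eG : a1 * (b1 * C / F) + a3 * a6 * (b3 * b6 / B) +
    a1 * (b1 * C / F) * a2 * a5 * (b2 * b5 / C) * a3 * a6 * (b3 * b6 / B) = G at hG ⊢
  generalize eT : a2 * b2 * a3 * b3 / P + Q * a8 * b8 / R +
    a2 * b2 * a3 * b3 / P * (a5 * b5 * a6 * b6 / Q) * (Q * a8 * b8 / R) = T at hT ⊢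
  have eC' : B * C = a2 * b2 * B + a6 * b6 * a8 * b8 * (1 + a2 * b2 * a5 * b5) := by
    rw [← eC]; field_simp; ring
  have eQ' : P * Q = a1 * b1 * a2 * b2 * (1 + a5 * b5 * a6 * b6) + a6 * b6 * P := by
    rw [← eQ]; field_simp; ring
  have hRF : R = F := by
    linear_combination -eR + eF - a1 * b1 * eC' + a8 * b8 * eQ' -
      (1 + a6 * b6 * a8 * b8) * eP + (1 + a1 * b1 * a2 * b2) * eB
  subst hRF
  have eG' : B * (R * G) = a1 * b1 * (B * C) + a3 * b3 * a6 * b6 * R +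
      a1 * b1 * a2 * b2 * a3 * b3 * a5 * b5 * a6 * b6 := by
    rw [← eG]; field_simp
  have eT' : P * (R * T) = a2 * b2 * a3 * b3 * R + P * Q * a8 * b8 +
      a2 * b2 * a3 * b3 * a5 * b5 * a6 * b6 * a8 * b8 := by
    rw [← eT]; field_simp
  have hRG : R * G = P * Q := mul_left_cancel₀ hB <| by
    linear_combination eG' - B * eQ' + (a1 * b1 + a3 * b3 * a6 * b6 * a1 * b1) * eC' -
      a3 * b3 * a6 * b6 * eF + a1 * b1 * a6 * b6 * (1 + a2 * b2 * a5 * b5) * eB +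
      B * a6 * b6 * eP
  have hRT : R * T = B * C := mul_left_cancel₀ hP <| by
    linear_combination eT' - P * eC' + (1 + a2 * b2 * a3 * b3) * a8 * b8 * eQ' -
      a2 * b2 * a3 * b3 * eR + a2 * b2 * a8 * b8 * (1 + a5 * b5 * a6 * b6) * eP +
      P * a2 * b2 * eB
  have hG' : G = P * Q / R := by rw [← hRG, mul_div_cancel_left₀ _ hR]
  have hT' : T = B * C / R := by rw [← hRT, mul_div_cancel_left₀ _ hR]
  clear eA eB eP eC eQ eF eR eG eT eC' eQ' eG' eT' hRG hRT hG hT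
  subst hG' hT'
  refine ⟨⟨trivial, ?_⟩, ⟨trivial, rfl⟩, ⟨trivial, ?_⟩, ⟨trivial, ?_⟩, ⟨trivial, rfl⟩,
    ⟨trivial, ?_⟩, ⟨trivial, ?_⟩, ⟨trivial, ?_⟩, ⟨trivial, ?_⟩, trivial⟩ <;> field_simp
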